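/- For every β with 0 < β < 1 and φ₀(x) = −(1/(4π(1−β))) log(1 + (π/(1−β))|x|^{2(1−β)}), the Dirichlet energy over the ball B_R(0) ⊂ ℝ² satisfies ∫_{B_R} |∇φ₀|² dx = (1/(2π)) log R + (1/(4π(1−β))) log(π/(1−β)) − 1/(4π(1−β)) + O(R^{−(2−2β)}) as R → +∞. -/

import Mathlib

open MeasureTheory Filter Set Metric
open scoped Topology RealInnerProductSpace ENNReal NNReal

noncomputable section

abbrev E2 : Type := EuclideanSpace ℝ (Fin 2)

/-- Smooth test functions compactly supported in `Ω`. -/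
def IsTestFun (Ω : Set E2) (φ : E2 → ℝ) : Prop :=
  ContDiff ℝ (⊤ : ℕ∞) φ ∧ HasCompactSupport φ ∧ tsupport φ ⊆ Ω

/-- `∫_Ω |∇u|² dx`. -/
def gradSq (Ω : Set E2) (u : E2 → ℝ) : ℝ := ∫ x in Ω, ‖gradient u x‖ ^ 2

/-- `∫_Ω u² dx`. -/
def sqL2 (Ω : Set E2) (u : E2 → ℝ) : ℝ := ∫ x in Ω, (u x) ^ 2

/-- Membership in `W₀^{1,2}(Ω)`: `u` vanishes outside `Ω` and is approximated in the
`H¹`-norm by smooth functions compactly supported in `Ω`. -/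
def MemW012 (Ω : Set E2) (u : E2 → ℝ) : Prop :=
  (∀ x, x ∉ Ω → u x = 0) ∧
  ∃ φ : ℕ → E2 → ℝ, (∀ n, IsTestFun Ω (φ n)) ∧
    Tendsto (fun n => ∫ x in Ω,
      (‖gradient (φ n) x - gradient u x‖ ^ 2 + (φ n x - u x) ^ 2)) atTop (𝓝 0)

/-- The norm `‖u‖_{1,α} = (∫_Ω |∇u|² - α ∫_Ω u²)^{1/2}`. -/
def norm1a (Ω : Set E2) (α : ℝ) (u : E2 → ℝ) : ℝ :=
  Real.sqrt (gradSq Ω u - α * sqL2 Ω u)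

/-- The first Dirichlet eigenvalue `λ₁(Ω)`. -/
def lambda1 (Ω : Set E2) : ℝ :=
  sInf {r : ℝ | ∃ u : E2 → ℝ, MemW012 Ω u ∧ sqL2 Ω u ≠ 0 ∧ r = gradSq Ω u / sqL2 Ω u}

/-- The singular Trudinger–Moser functional `∫_Ω |x|^{-2β} e^{γ u²} dx`. -/
def singTM (Ω : Set E2) (β γ : ℝ) (u : E2 → ℝ) : ℝ :=
  ∫ x in Ω, ‖x‖ ^ (-2 * β) * Real.exp (γ * (u x) ^ 2)

/-- `λ_ε = ∫_Ω |x|^{-2β} u² e^{4π(1-β-ε)u²} dx`. -/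
def lamEps (Ω : Set E2) (β ε : ℝ) (u : E2 → ℝ) : ℝ :=
  ∫ x in Ω, ‖x‖ ^ (-2 * β) * (u x) ^ 2 * Real.exp (4 * Real.pi * (1 - β - ε) * (u x) ^ 2)

/-- `u` solves `-Δu - αu = λ⁻¹ |x|^{-2β} u e^{4π(1-β-ε)u²}` in the distributional sense. -/
def SolvesEL (Ω : Set E2) (β α ε lam : ℝ) (u : E2 → ℝ) : Prop :=
  ∀ φ : E2 → ℝ, IsTestFun Ω φ →
    (∫ x in Ω, ⟪gradient u x, gradient φ x⟫) - α * ∫ x in Ω, u x * φ x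
      = lam⁻¹ * ∫ x in Ω, ‖x‖ ^ (-2 * β) * u x *
          Real.exp (4 * Real.pi * (1 - β - ε) * (u x) ^ 2) * φ x

/-- `uε` is a nonnegative maximizer, with `‖uε‖_{1,α} = 1`, of the subcritical singular
Trudinger–Moser functional over `{u ∈ W₀^{1,2}(Ω) : ‖u‖_{1,α} ≤ 1}`. -/
def IsSubMax (Ω : Set E2) (β α ε : ℝ) (uε : E2 → ℝ) : Prop :=
  MemW012 Ω uε ∧ (∀ x ∈ Ω, 0 ≤ uε x) ∧ norm1a Ω α uε = 1 ∧
  ∀ u : E2 → ℝ, MemW012 Ω u → norm1a Ω α u ≤ 1 →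
    singTM Ω β (4 * Real.pi * (1 - β - ε)) u ≤ singTM Ω β (4 * Real.pi * (1 - β - ε)) uε

/-- The blow-up scale `r_ε = √λ_ε · c_ε⁻¹ · e^{-2π(1-β-ε)c_ε²}`. -/
def blowR (Ω : Set E2) (β : ℝ) (u : ℝ → E2 → ℝ) (c : ℝ → ℝ) (ε : ℝ) : ℝ :=
  Real.sqrt (lamEps Ω β ε (u ε)) / c ε * Real.exp (-(2 * Real.pi) * (1 - β - ε) * (c ε) ^ 2)


/-- The gradient of a radial function has norm equal to the absolute radial derivative. -/
lemma norm_gradient_comp_norm {E : Type*} [NormedAddCommGroup E] [InnerProductSpace ℝ E]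
    [CompleteSpace E] {g : ℝ → ℝ} {g' : ℝ} {x : E} (hx : x ≠ 0) (hg : HasDerivAt g g' ‖x‖) :
    ‖gradient (fun z : E => g ‖z‖) x‖ = |g'| := by
  have : Nontrivial E := ⟨x, 0, hx⟩
  have hn : DifferentiableAt ℝ (fun z : E => ‖z‖) x := differentiableAt_id.norm ℝ hx
  have h : HasFDerivAt (fun z : E => g ‖z‖) (g' • fderiv ℝ (fun z : E => ‖z‖) x) x :=
    hg.comp_hasFDerivAt x hn.hasFDerivAt
  rw [gradient, LinearIsometryEquiv.norm_map, h.fderiv, norm_smul, norm_fderiv_norm hn, mul_one,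
    Real.norm_eq_abs]

/-- Integration of a radial function over a planar ball in polar coordinates. -/
lemma setIntegral_ball_fun_norm (f : ℝ → ℝ) {R : ℝ} (hR : 0 ≤ R) :
    ∫ x in Metric.ball (0 : E2) R, f ‖x‖ = 2 * Real.pi * ∫ r in (0 : ℝ)..R, r * f r := by
  have hball : (fun x : E2 => (Metric.ball (0 : E2) R).indicator (fun x => f ‖x‖) x) =
      fun x : E2 => (Iio R).indicator f ‖x‖ := by
    ext x
    simp [indicator]
  rw [← integral_indicator measurableSet_ball, hball, integral_fun_norm_addHaar]
  have hind : (fun y : ℝ => y ^ (Module.finrank ℝ E2 - 1) • (Iio R).indicator f y) =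
      (Iio R).indicator fun y => y * f y := by
    ext y
    simp [indicator]
  rw [hind, setIntegral_indicator measurableSet_Iio, Ioi_inter_Iio,
    intervalIntegral.integral_of_le hR, integral_Ioc_eq_integral_Ioo]
  have hvol : volume.real (Metric.ball (0 : E2) 1) = Real.pi := by
    simp [Measure.real, Real.pi_pos.le]
  rw [hvol]
  simp [mul_assoc]

/-- The radial energy density of the bubble profile has an elementary antiderivative. -/
lemma hasDerivAt_bubble_energy {s a r : ℝ} (ha : 0 < a) (hr : 0 < r) :
    HasDerivAt (fun r : ℝ => Real.log (1 + a * r ^ (2 * s)) + 1 / (1 + a * r ^ (2 * s)))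
      (2 * s * (a * r ^ (2 * s)) ^ 2 / (r * (1 + a * r ^ (2 * s)) ^ 2)) r := by
  have hp : 0 < 1 + a * r ^ (2 * s) := by positivity
  have h : HasDerivAt (fun r : ℝ => 1 + a * r ^ (2 * s)) (a * (2 * s * r ^ (2 * s - 1))) r :=
    ((Real.hasDerivAt_rpow_const (Or.inl hr.ne')).const_mul a).const_add 1
  have h2 := (h.log hp.ne').add (h.inv hp.ne')
  simp only [one_div]
  refine h2.congr_deriv ?_
  rw [Real.rpow_sub_one hr.ne']
  field_simp
  ring

lemma hasDerivAt_bubble {s a c r : ℝ} (ha : 0 < a) (hr : 0 < r) :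
    HasDerivAt (fun r : ℝ => c * Real.log (1 + a * r ^ (2 * s)))
      (c * (2 * s * (a * r ^ (2 * s)) / (r * (1 + a * r ^ (2 * s))))) r := by
  have hp : 0 < 1 + a * r ^ (2 * s) := by positivity
  have h : HasDerivAt (fun r : ℝ => 1 + a * r ^ (2 * s)) (a * (2 * s * r ^ (2 * s - 1))) r :=
    ((Real.hasDerivAt_rpow_const (Or.inl hr.ne')).const_mul a).const_add 1
  refine ((h.log hp.ne').const_mul c).congr_deriv ?_
  rw [Real.rpow_sub_one hr.ne']
  field_simp

/-- Closed form of the Dirichlet energy of a bubble profile on a planar ball. -/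
lemma setIntegral_ball_norm_gradient_bubble {s a : ℝ} (c : ℝ) (hs : 0 < s) (ha : 0 < a) {R : ℝ}
    (hR : 0 ≤ R) :
    ∫ x in Metric.ball (0 : E2) R,
        ‖gradient (fun z : E2 => c * Real.log (1 + a * ‖z‖ ^ (2 * s))) x‖ ^ 2 =
      4 * Real.pi * c ^ 2 * s *
        (Real.log (1 + a * R ^ (2 * s)) + 1 / (1 + a * R ^ (2 * s)) - 1) := by
  have hgrad : ∀ x : E2, x ≠ 0 →
      ‖gradient (fun z : E2 => c * Real.log (1 + a * ‖z‖ ^ (2 * s))) x‖ ^ 2 =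
        (c * (2 * s * (a * ‖x‖ ^ (2 * s)) / (‖x‖ * (1 + a * ‖x‖ ^ (2 * s))))) ^ 2 := by
    intro x hx
    rw [norm_gradient_comp_norm hx (hasDerivAt_bubble ha (norm_pos_iff.mpr hx)), sq_abs]
  have hae : ∀ᵐ x ∂(volume.restrict (Metric.ball (0 : E2) R)), x ≠ 0 :=
    ae_restrict_of_ae (Measure.ae_ne volume 0)
  rw [integral_congr_ae (hae.mono hgrad),
    setIntegral_ball_fun_norm
      (fun r => (c * (2 * s * (a * r ^ (2 * s)) / (r * (1 + a * r ^ (2 * s))))) ^ 2) hR]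
  have hdens : ∀ r : ℝ, r * (c * (2 * s * (a * r ^ (2 * s)) / (r * (1 + a * r ^ (2 * s))))) ^ 2 =
      2 * s * c ^ 2 * (2 * s * (a * r ^ (2 * s)) ^ 2 / (r * (1 + a * r ^ (2 * s)) ^ 2)) := by
    intro r
    rcases eq_or_ne r 0 with rfl | hr
    · simp
    · field_simp
  simp only [hdens, intervalIntegral.integral_const_mul]
  have hcont : ContinuousOn
      (fun r : ℝ => Real.log (1 + a * r ^ (2 * s)) + 1 / (1 + a * r ^ (2 * s))) (Icc 0 R) := by
    have hbase : Continuous fun r : ℝ => 1 + a * r ^ (2 * s) :=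
      continuous_const.add (continuous_const.mul (Real.continuous_rpow_const (by positivity)))
    have hne : ∀ r ∈ Icc 0 R, 1 + a * r ^ (2 * s) ≠ 0 := by
      intro r hr
      have := Real.rpow_nonneg hr.1 (2 * s)
      positivity
    exact (hbase.continuousOn.log hne).add (continuousOn_const.div hbase.continuousOn hne)
  have hderiv : ∀ r ∈ Ioo 0 R, HasDerivAt
      (fun r : ℝ => Real.log (1 + a * r ^ (2 * s)) + 1 / (1 + a * r ^ (2 * s)))
      (2 * s * (a * r ^ (2 * s)) ^ 2 / (r * (1 + a * r ^ (2 * s)) ^ 2)) r :=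
    fun r hr => hasDerivAt_bubble_energy ha hr.1
  have hint := intervalIntegral.integrableOn_deriv_of_nonneg hcont hderiv fun r hr => by
    have := hr.1
    positivity
  rw [intervalIntegral.integral_eq_sub_of_hasDerivAt_of_le hR hcont hderiv
    ((intervalIntegrable_iff_integrableOn_Ioc_of_le hR).mpr hint)]
  rw [Real.zero_rpow (by positivity)]
  simp
  ring

/-- Asymptotics of `log (1 + t) + 1 / (1 + t)` for large `t`. -/
lemma abs_log_one_add_add_inv_sub_log_le {t : ℝ} (ht : 0 < t) :
    |Real.log (1 + t) + 1 / (1 + t) - Real.log t| ≤ 2 / t := by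
  have hlog : Real.log (1 + t) - Real.log t ≤ 1 / t := by
    rw [← Real.log_div (by positivity) ht.ne']
    refine (Real.log_le_sub_one_of_pos (by positivity)).trans_eq ?_
    field_simp
    ring
  have hmono : Real.log t ≤ Real.log (1 + t) := Real.log_le_log ht (by linarith)
  have hinv : 1 / (1 + t) ≤ 1 / t := one_div_le_one_div_of_le ht (by linarith)
  have hpos : 0 < 1 / (1 + t) := by positivity
  have htwo : 2 / t = 1 / t + 1 / t := by ring
  rw [abs_of_nonneg (by linarith)]
  linarith

/-- For `0 < β < 1` and `φ₀(x) = -(1/(4π(1-β))) log(1 + (π/(1-β))|x|^{2(1-β)})`, the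
Dirichlet energy on `B_R(0) ⊂ ℝ²` satisfies
`∫_{B_R} |∇φ₀|² dx = (1/(2π)) log R + (1/(4π(1-β))) log(π/(1-β)) - 1/(4π(1-β)) + O(R^{-(2-2β)})`
as `R → +∞`. -/
theorem bubble_dirichlet_energy_asymptotics (β : ℝ) (hβ0 : 0 < β) (hβ1 : β < 1) :
    ∃ C R₀ : ℝ, ∀ R : ℝ, R₀ ≤ R →
      |(∫ x in Metric.ball (0 : E2) R,
          ‖gradient (fun z : E2 => -(1 / (4 * Real.pi * (1 - β))) *
            Real.log (1 + Real.pi / (1 - β) * ‖z‖ ^ (2 * (1 - β)))) x‖ ^ 2) -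
        (1 / (2 * Real.pi) * Real.log R
          + 1 / (4 * Real.pi * (1 - β)) * Real.log (Real.pi / (1 - β))
          - 1 / (4 * Real.pi * (1 - β)))|
      ≤ C * R ^ (-(2 - 2 * β)) := by
  have hs : 0 < 1 - β := by linarith
  have hpi := Real.pi_pos
  refine ⟨1 / (2 * Real.pi ^ 2), 1, fun R hR => ?_⟩
  have hR0 : 0 < R := by linarith
  rw [setIntegral_ball_norm_gradient_bubble _ hs (by positivity) hR0.le]
  have ht : 0 < Real.pi / (1 - β) * R ^ (2 * (1 - β)) := by positivity
  have hlog : Real.log (Real.pi / (1 - β) * R ^ (2 * (1 - β))) =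
      Real.log (Real.pi / (1 - β)) + 2 * (1 - β) * Real.log R := by
    rw [Real.log_mul (by positivity) (by positivity), Real.log_rpow hR0]
  have hbound := abs_log_one_add_add_inv_sub_log_le ht
  have hexp : R ^ (-(2 - 2 * β)) = (R ^ (2 * (1 - β)))⁻¹ := by
    rw [← Real.rpow_neg hR0.le]
    ring_nf
  rw [hexp]
  generalize Real.log (1 + Real.pi / (1 - β) * R ^ (2 * (1 - β))) +
    1 / (1 + Real.pi / (1 - β) * R ^ (2 * (1 - β))) = A at hbound ⊢
  rw [hlog] at hbound
  calc _ = |1 / (4 * Real.pi * (1 - β)) *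
        (A - (Real.log (Real.pi / (1 - β)) + 2 * (1 - β) * Real.log R))| := by
        congr 1
        field_simp
        ring
    _ ≤ 1 / (4 * Real.pi * (1 - β)) * (2 / (Real.pi / (1 - β) * R ^ (2 * (1 - β)))) := by
        rw [abs_mul, abs_of_pos (by positivity)]
        gcongr
    _ = _ := by
        field_simp
        ring

end
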